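/- arXiv:2507.13007 — 3 statements merged into one kernel-verified Lean document; each statement's English description precedes it below -/
import Mathlib

section
/- (Theorem 1 of the paper.) Let C be a family of local constraints over variable set V with domains D, indexed by a finite nonempty index type ι, with scope function S : ι → Set V, and suppose C is an Irreducible Infeasible Subsystem (IIS): the full system indexed by ι is infeasible, and for every proper subset T ⊊ ι the subsystem indexed by T is feasible. Then the dual graph of C — the simple graph on vertex set ι in which distinct i and j are adjacent iff S(i) ∩ S(j) ≠ ∅ — is connected. -/
/-- Theorem 1 of the paper: the dual graph of an Irreducible Infeasible
Subsystem of local constraints is connected. -/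
theorem dualGraph_connected_of_IIS
    {V : Type*} {D : V → Type*} [∀ v, Nonempty (D v)]
    {ι : Type*} [Fintype ι] [Nonempty ι]
    (S : ι → Set V) (c : ι → ((v : V) → D v) → Prop)
    (hloc : ∀ i (x y : (v : V) → D v),
      (∀ v ∈ S i, x v = y v) → (c i x ↔ c i y))
    (hinfeas : ¬ ∃ x : (v : V) → D v, ∀ i : ι, c i x)
    (hirr : ∀ T : Set ι, T ⊂ Set.univ → ∃ x : (v : V) → D v, ∀ i ∈ T, c i x)
    (G : SimpleGraph ι)
    (hG : ∀ i j : ι, G.Adj i j ↔ i ≠ j ∧ (S i ∩ S j).Nonempty) :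
    G.Connected := by
  classical
  refine (SimpleGraph.connected_iff G).2 ⟨fun i j => ?_, inferInstance⟩
  by_contra hij
  obtain ⟨x, hx⟩ := hirr {k | G.Reachable i k}
    (Set.ssubset_univ_iff.2 fun h => hij (h.symm.subset (Set.mem_univ j)))
  obtain ⟨y, hy⟩ := hirr {k | ¬ G.Reachable i k}
    (Set.ssubset_univ_iff.2 fun h =>
      h.symm.subset (Set.mem_univ i) (SimpleGraph.Reachable.refl i))
  -- Use `x` on the variables of the component of `i`, and `y` elsewhere.
  refine hinfeas ⟨fun v => if ∃ k, G.Reachable i k ∧ v ∈ S k then x v else y v, fun k => ?_⟩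
  by_cases hk : G.Reachable i k
  · exact (hloc k _ x fun v hv => if_pos ⟨k, hk, hv⟩).2 (hx k hk)
  · refine (hloc k _ y fun v hv => if_neg ?_).2 (hy k hk)
    rintro ⟨l, hl, hvl⟩
    have hlk : l ≠ k := fun h => hk (h ▸ hl)
    exact hk (hl.trans ((hG l k).2 ⟨hlk, v, hvl, hv⟩).reachable)
end

section
/- Let C be a family of local constraints over variable set V with domains D, indexed by a finite index type ι, with scope function S : ι → Set V, and suppose C is an Irreducible Infeasible Subsystem (IIS). Then there is no partition of ι into two disjoint nonempty subsets A and B such that the scopes are disjoint across the two parts, i.e., such that S(i) ∩ S(j) = ∅ for every i ∈ A and j ∈ B. -/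
/-- an Irreducible Infeasible Subsystem admits no partition of its index set
into two disjoint nonempty parts whose scopes are disjoint across the parts. -/
theorem IIS_no_scope_disjoint_partition
    {V : Type*} {D : V → Type*} [∀ v, Nonempty (D v)]
    {ι : Type*} [Fintype ι]
    (S : ι → Set V) (c : ι → ((v : V) → D v) → Prop)
    (hloc : ∀ i (x y : (v : V) → D v),
      (∀ v ∈ S i, x v = y v) → (c i x ↔ c i y))
    (hinfeas : ¬ ∃ x : (v : V) → D v, ∀ i : ι, c i x)
    (hirr : ∀ T : Set ι, T ⊂ Set.univ → ∃ x : (v : V) → D v, ∀ i ∈ T, c i x) :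
    ¬ ∃ A B : Set ι, A.Nonempty ∧ B.Nonempty ∧ A ∩ B = ∅ ∧ A ∪ B = Set.univ ∧
      (∀ i ∈ A, ∀ j ∈ B, S i ∩ S j = ∅) := by
  classical
  rintro ⟨A, B, ⟨a, ha⟩, ⟨b, hb⟩, hAB, hU, hS⟩
  have hdisj : ∀ i, i ∈ A → i ∉ B := fun i hi hi' =>
    Set.eq_empty_iff_forall_notMem.mp hAB i ⟨hi, hi'⟩
  obtain ⟨x, hx⟩ := hirr A (Set.ssubset_univ_iff.mpr fun h => hdisj b (h ▸ Set.mem_univ b) hb)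
  obtain ⟨y, hy⟩ := hirr B (Set.ssubset_univ_iff.mpr fun h => hdisj a ha (h ▸ Set.mem_univ a))
  refine hinfeas ⟨fun v => if ∃ i ∈ A, v ∈ S i then x v else y v, fun i => ?_⟩
  have hi : i ∈ A ∪ B := hU ▸ Set.mem_univ i
  rcases hi with hi | hi
  · exact (hloc i _ x fun v hv => if_pos ⟨i, hi, hv⟩).mpr (hx i hi)
  · refine (hloc i _ y fun v hv => if_neg ?_).mpr (hy i hi)
    rintro ⟨k, hk, hvk⟩
    exact Set.eq_empty_iff_forall_notMem.mp (hS k hk i hi) v ⟨hvk, hv⟩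
end

section
/- Let C be a family of local constraints over variable set V with domains D, indexed by a finite index type ι with at least two elements, with scope function S : ι → Set V, and suppose C is an Irreducible Infeasible Subsystem (IIS). Then no constraint is isolated in the dual graph: for every i ∈ ι there exists j ∈ ι with j ≠ i and S(i) ∩ S(j) ≠ ∅. -/
/-- in an Irreducible Infeasible Subsystem with at least two constraints,
no constraint is isolated in the dual graph: every constraint shares a scope variable
with some other constraint. -/
theorem IIS_no_isolated_constraint
    {V : Type*} {D : V → Type*} [∀ v, Nonempty (D v)]
    {ι : Type*} [Fintype ι] [Nontrivial ι]
    (S : ι → Set V) (c : ι → ((v : V) → D v) → Prop)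
    (hloc : ∀ i (x y : (v : V) → D v),
      (∀ v ∈ S i, x v = y v) → (c i x ↔ c i y))
    (hinfeas : ¬ ∃ x : (v : V) → D v, ∀ i : ι, c i x)
    (hirr : ∀ T : Set ι, T ⊂ Set.univ → ∃ x : (v : V) → D v, ∀ i ∈ T, c i x) :
    ∀ i : ι, ∃ j : ι, j ≠ i ∧ (S i ∩ S j).Nonempty := by
  classical
  intro i
  by_contra! h
  obtain ⟨k, hk⟩ := exists_ne i
  obtain ⟨x, hx⟩ := hirr {i} (Set.ssubset_univ_iff.2 fun e =>
    hk (e.symm.subset (Set.mem_univ k)))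
  obtain ⟨y, hy⟩ := hirr {i}ᶜ (Set.ssubset_univ_iff.2 fun e =>
    e.symm.subset (Set.mem_univ i) rfl)
  refine hinfeas ⟨fun v => if v ∈ S i then x v else y v, fun j => ?_⟩
  by_cases hj : j = i
  · subst hj
    exact (hloc j x _ fun v hv => (if_pos hv).symm).1 (hx j rfl)
  · refine (hloc j y _ fun v hv => (if_neg fun hvi => ?_).symm).1 (hy j hj)
    have hmem : v ∈ S i ∩ S j := ⟨hvi, hv⟩
    simp [h j hj] at hmem
end
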